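/- Let v = (a,b,c,d) and w be integer root quadruples (so each has its entries listed in increasing order). If w is obtained from v by applying a finite product of the matrices S₁, S₂, S₃, S₄ followed by a permutation of the four coordinates, then w = v. -/

import Mathlib

/-- The generators `S₁, S₂, S₃, S₄` of the Apollonian group.  `S i` agrees with
the identity matrix except in row `i`, which has `-1` on the diagonal and `2`
in the other positions. -/
def S (i : Fin 4) : Matrix (Fin 4) (Fin 4) ℤ :=
  Matrix.of fun k l => if k = i then (if l = i then -1 else 2) else (if k = l then 1 else 0)

/-- `v` is a root quadruple: an integer Descartes quadruple, with entries in
increasing order, satisfying `v 0 ≤ 0 ≤ v 1 ≤ v 2 ≤ v 3`, positive entry-sum,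
and `v 0 + v 1 + v 2 ≥ v 3`. -/
def IsRootQuadruple (v : Fin 4 → ℤ) : Prop :=
  2 * (v 0 ^ 2 + v 1 ^ 2 + v 2 ^ 2 + v 3 ^ 2) = (v 0 + v 1 + v 2 + v 3) ^ 2 ∧
  v 0 ≤ 0 ∧ 0 ≤ v 1 ∧ v 1 ≤ v 2 ∧ v 2 ≤ v 3 ∧
  0 < v 0 + v 1 + v 2 + v 3 ∧ v 3 ≤ v 0 + v 1 + v 2

theorem S_mulVec (i : Fin 4) (x : Fin 4 → ℤ) :
    (S i).mulVec x = Function.update x i (2 * ∑ j, x j - 3 * x i) := by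
  ext k
  fin_cases i <;> fin_cases k <;>
    simp [S, Matrix.mulVec, dotProduct, Fin.sum_univ_four] <;> ring

theorem sum_S_mulVec (i : Fin 4) (x : Fin 4 → ℤ) :
    ∑ j, (S i).mulVec x j = 3 * ∑ j, x j - 4 * x i := by
  rw [S_mulVec]
  fin_cases i <;> simp [Fin.sum_univ_four] <;> ring

theorem S_mulVec_self (i : Fin 4) (x : Fin 4 → ℤ) :
    (S i).mulVec x i = 2 * ∑ j, x j - 3 * x i := by
  simp [S_mulVec]

theorem S_mulVec_S_mulVec (i : Fin 4) (x : Fin 4 → ℤ) :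
    (S i).mulVec ((S i).mulVec x) = x := by
  rw [S_mulVec, sum_S_mulVec, S_mulVec_self, S_mulVec, Function.update_idem]
  convert Function.update_eq_self i x using 2
  ring

theorem S_mulVec_eq_self {i : Fin 4} {x : Fin 4 → ℤ} (h : 2 * x i = ∑ j, x j) :
    (S i).mulVec x = x := by
  rw [S_mulVec]
  convert Function.update_eq_self i x using 2
  linarith

/-- Descartes quadruples with positive entry-sum. -/
def IsPosDescartes (x : Fin 4 → ℤ) : Prop :=
  2 * ∑ j, x j ^ 2 = (∑ j, x j) ^ 2 ∧ 0 < ∑ j, x j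

theorem IsPosDescartes.add_le_sum {x : Fin 4 → ℤ} (h : IsPosDescartes x) {i j : Fin 4}
    (hij : i ≠ j) : x i + x j ≤ ∑ k, x k := by
  have key : ∀ a b c d : ℤ, 2 * (a ^ 2 + b ^ 2 + c ^ 2 + d ^ 2) = (a + b + c + d) ^ 2 →
      0 < a + b + c + d → 0 ≤ c + d := by
    intro a b c d h₁ h₂
    by_contra! hneg
    nlinarith [sq_nonneg (a - b), sq_nonneg (c - d),
      mul_pos (neg_pos.2 hneg) (by linarith : 0 < a + b)]
  obtain ⟨h₁, h₂⟩ := h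
  simp only [Fin.sum_univ_four] at h₁ h₂ ⊢
  have h01 := key (x 0) (x 1) (x 2) (x 3) (by linarith) (by linarith)
  have h02 := key (x 0) (x 2) (x 1) (x 3) (by linarith) (by linarith)
  have h03 := key (x 0) (x 3) (x 1) (x 2) (by linarith) (by linarith)
  have h12 := key (x 1) (x 2) (x 0) (x 3) (by linarith) (by linarith)
  have h13 := key (x 1) (x 3) (x 0) (x 2) (by linarith) (by linarith)
  have h23 := key (x 2) (x 3) (x 0) (x 1) (by linarith) (by linarith)
  fin_cases i <;> fin_cases j <;> simp at hij ⊢ <;> linarith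

theorem IsPosDescartes.S_mulVec {x : Fin 4 → ℤ} (h : IsPosDescartes x) {i : Fin 4}
    (hi : 2 * x i ≤ ∑ j, x j) : IsPosDescartes ((S i).mulVec x) := by
  obtain ⟨h₁, h₂⟩ := h
  refine ⟨?_, by rw [sum_S_mulVec]; linarith⟩
  rw [sum_S_mulVec, _root_.S_mulVec]
  simp only [Fin.sum_univ_four] at h₁ ⊢
  fin_cases i <;> simp <;> linear_combination h₁

/-- Quadruples obtained from `v` by successively applying generators none of which decreases
the entry-sum. -/
inductive Ascends (v : Fin 4 → ℤ) : (Fin 4 → ℤ) → Prop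
  | refl : Ascends v v
  | step {x : Fin 4 → ℤ} (i : Fin 4) : Ascends v x → 2 * x i ≤ ∑ j, x j →
      Ascends v ((S i).mulVec x)

namespace Ascends

variable {v x : Fin 4 → ℤ}

theorem isPosDescartes (hv : IsPosDescartes v) (h : Ascends v x) : IsPosDescartes x := by
  induction h with
  | refl => exact hv
  | step i _ hi ih => exact ih.S_mulVec hi

theorem S_mulVec (hv : IsPosDescartes v) (hred : ∀ i, 2 * v i ≤ ∑ j, v j) (h : Ascends v x)
    (i : Fin 4) : Ascends v ((S i).mulVec x) := by
  by_cases hi : 2 * x i ≤ ∑ j, x j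
  · exact h.step i hi
  have hx := h.isPosDescartes hv
  cases h with
  | refl => exact absurd (hred i) hi
  | @step y k hy hk =>
    obtain rfl | hik := eq_or_ne i k
    · rwa [S_mulVec_S_mulVec]
    · have hle := hx.add_le_sum hik
      have hself := S_mulVec_self k y
      have hsum := sum_S_mulVec k y
      linarith

theorem list_prod_mulVec (hv : IsPosDescartes v) (hred : ∀ i, 2 * v i ≤ ∑ j, v j)
    (l : List (Fin 4)) : Ascends v ((l.map S).prod.mulVec v) := by
  induction l with
  | nil => simpa using refl
  | cons i l ih =>
    rw [List.map_cons, List.prod_cons, ← Matrix.mulVec_mulVec]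
    exact ih.S_mulVec hv hred i

theorem eq_of_two_mul_le_sum (h : Ascends v x) (hred : ∀ i, 2 * x i ≤ ∑ j, x j) : x = v := by
  induction h with
  | refl => rfl
  | @step y i hy hi ih =>
    have hself := S_mulVec_self i y
    have hsum := sum_S_mulVec i y
    have hfix : (S i).mulVec y = y := S_mulVec_eq_self (by linarith [hred i])
    rw [hfix] at hred ⊢
    exact ih hred

end Ascends

namespace IsRootQuadruple

variable {v : Fin 4 → ℤ}

theorem isPosDescartes (h : IsRootQuadruple v) : IsPosDescartes v := by
  obtain ⟨h₁, -, -, -, -, h₂, -⟩ := h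
  exact ⟨by simpa only [Fin.sum_univ_four] using h₁, by simpa only [Fin.sum_univ_four] using h₂⟩

theorem two_mul_le_sum (h : IsRootQuadruple v) (i : Fin 4) : 2 * v i ≤ ∑ j, v j := by
  obtain ⟨-, h₀, h₁, h₂, h₃, -, h₄⟩ := h
  fin_cases i <;> simp [Fin.sum_univ_four] <;> linarith

theorem monotone (h : IsRootQuadruple v) : Monotone v := by
  obtain ⟨-, h₀, h₁, h₂, h₃, -, -⟩ := h
  rw [Fin.monotone_iff_le_succ]
  intro i
  fin_cases i
  exacts [h₀.trans h₁, h₂, h₃]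

end IsRootQuadruple

/-- **Uniqueness of the root quadruple.** If two integer root quadruples `v`
and `w` are related by a finite product of the matrices `S₁, S₂, S₃, S₄`
followed by a permutation of the coordinates, then `w = v`. -/
theorem root_quadruple_unique (v w : Fin 4 → ℤ)
    (hv : IsRootQuadruple v) (hw : IsRootQuadruple w)
    (l : List (Fin 4)) (σ : Equiv.Perm (Fin 4))
    (h : w = ((l.map S).prod.mulVec v) ∘ σ) :
    w = v := by
  have hasc := Ascends.list_prod_mulVec hv.isPosDescartes hv.two_mul_le_sum l
  have hx : (l.map S).prod.mulVec v = v := by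
    refine hasc.eq_of_two_mul_le_sum fun i => ?_
    have hi := hw.two_mul_le_sum (σ.symm i)
    rw [h] at hi
    simpa [Equiv.sum_comp σ ((l.map S).prod.mulVec v)] using hi
  rw [hx] at h
  rw [h]
  exact Tuple.unique_monotone (σ := σ) (τ := 1) (h ▸ hw.monotone) hv.monotone
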